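/- arXiv:1706.08022 — 6 statements merged into one kernel-verified Lean document; each statement's English description precedes it below -/
import Mathlib

section
/- For each real number a with 0 < a ≤ 1, the operator e^D − aI on H(ℂ), given by (Tf)(z) = f(z + 1) − a·f(z), supports a hypercyclic algebra: there exists an entire function f such that every nonzero element of the non-unital subalgebra generated by f (equivalently, every nonzero P(f) for a nonzero complex polynomial P with P(0) = 0) is hypercyclic for T. -/
open Set Polynomial

noncomputable section

abbrev Entire : Type := {f : C(ℂ, ℂ) // Differentiable ℂ (⇑f)}

instance : Zero Entire := ⟨⟨0, by rw [ContinuousMap.coe_zero]; exact differentiable_const 0⟩⟩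

def Hypercyclic {X : Type*} [TopologicalSpace X] (T : X → X) (x : X) : Prop :=
  Dense (Set.range fun n : ℕ => T^[n] x)

def polyApply (P : Polynomial ℂ) (f : Entire) : Entire :=
  ⟨⟨fun z => P.eval (f.1 z), by exact (P.differentiable.comp f.2).continuous⟩,
   by exact P.differentiable.comp f.2⟩

def GeneratesHCAlgebra (T : Entire → Entire) (f : Entire) : Prop :=
  ∀ P : Polynomial ℂ, P.coeff 0 = 0 → polyApply P f ≠ 0 → Hypercyclic T (polyApply P f)

def ExpType (a : ℕ → ℂ) : Prop :=
  ∃ M > (0:ℝ), ∃ R > (0:ℝ), ∀ n : ℕ, ‖a n‖ ≤ M * R ^ n / n.factorial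

def IsCompactArc (Γ : Set ℂ) : Prop :=
  ∃ γ : ℝ → ℂ, ContinuousOn γ (Icc 0 1) ∧ InjOn γ (Icc 0 1) ∧ Γ = γ '' Icc 0 1

def StrictlyConvexArc (Γ : Set ℂ) : Prop :=
  IsCompactArc Γ ∧
  ∀ z₁ ∈ Γ, ∀ z₂ ∈ Γ, ∀ u ∈ segment ℝ z₁ z₂ ∩ Γ, ∀ v ∈ segment ℝ z₁ z₂ ∩ Γ,
    ∀ w ∈ segment ℝ z₁ z₂ ∩ Γ, u = v ∨ u = w ∨ v = w

open Filter Topology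

/-- The exponential `z ↦ exp (μ z)` as a continuous function. -/
def expMap (μ : ℂ) : C(ℂ, ℂ) := ⟨fun z => Complex.exp (μ * z), by fun_prop⟩

/-- The symbol `μ ↦ exp μ - a` of the operator `e^D - a I`. -/
def symbol (a : ℝ) (μ : ℂ) : ℂ := Complex.exp μ - a

/-- The operator `e^D - a I` on the space of all continuous functions. -/
def shiftOp (a : ℝ) : C(ℂ, ℂ) →L[ℂ] C(ℂ, ℂ) where
  toFun f := f.comp ⟨fun z => z + 1, by fun_prop⟩ - (a : ℂ) • f
  map_add' f g := by ext z; simp; ring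
  map_smul' c f := by ext z; simp; ring
  cont := by
    exact (ContinuousMap.continuous_precomp _).sub (continuous_const_smul (a : ℂ))

lemma shiftOp_apply (a : ℝ) (f : C(ℂ, ℂ)) (z : ℂ) :
    shiftOp a f z = f (z + 1) - (a : ℂ) * f z := rfl

lemma expMap_add (μ ν : ℂ) : expMap (μ + ν) = expMap μ * expMap ν := by
  ext z; simp [expMap, add_mul, Complex.exp_add]

lemma expMap_zero : expMap 0 = 1 := by
  ext z; simp [expMap]

lemma expMap_pow (μ : ℂ) (n : ℕ) : expMap μ ^ n = expMap (n * μ) := by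
  induction n with
  | zero => simp [expMap_zero]
  | succ n ih => rw [pow_succ, ih, ← expMap_add]; congr 1; push_cast; ring

lemma prod_expMap {ι : Type*} (s : Finset ι) (μ : ι → ℂ) :
    ∏ i ∈ s, expMap (μ i) = expMap (∑ i ∈ s, μ i) := by
  classical
  induction s using Finset.induction_on with
  | empty => simp [expMap_zero]
  | insert i s hi ih => rw [Finset.prod_insert hi, Finset.sum_insert hi, ih, expMap_add]

lemma differentiable_expMap (μ : ℂ) : Differentiable ℂ (expMap μ) := by
  change Differentiable ℂ (fun z => Complex.exp (μ * z))
  fun_prop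

lemma shiftOp_expMap (a : ℝ) (μ : ℂ) : shiftOp a (expMap μ) = symbol a μ • expMap μ := by
  ext z
  simp [shiftOp_apply, expMap, symbol, mul_add, Complex.exp_add]
  ring

lemma shiftOp_pow_expMap (a : ℝ) (μ : ℂ) (n : ℕ) :
    (shiftOp a ^ n) (expMap μ) = symbol a μ ^ n • expMap μ := by
  induction n with
  | zero => simp
  | succ n ih =>
    rw [pow_succ', mul_apply_eq_comp, ih, map_smul, shiftOp_expMap, smul_smul, pow_succ]

/-- Along exponentials, the powers of `shiftOp` act geometrically. -/
lemma tendsto_shiftOp_pow_smul_expMap (a : ℝ) (c r μ : ℂ) (h : ‖r * symbol a μ‖ < 1) :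
    Tendsto (fun N => (shiftOp a ^ N) ((c * r ^ N) • expMap μ)) atTop (𝓝 0) := by
  have h1 : Tendsto (fun N : ℕ => (c * (r * symbol a μ) ^ N) • expMap μ) atTop
      (𝓝 ((c * 0 : ℂ) • expMap μ)) :=
    ((tendsto_pow_atTop_nhds_zero_of_norm_lt_one h).const_mul c).smul_const (expMap μ)
  rw [mul_zero, zero_smul ℂ (expMap μ)] at h1
  refine h1.congr fun N => ?_
  rw [map_smul, shiftOp_pow_expMap, smul_smul, mul_pow]
  congr 1; ring

lemma continuousMap_tendsto_taylor (f : C(ℂ, ℂ)) (hf : Differentiable ℂ f) :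
    ∃ P : ℕ → Polynomial ℂ,
      Tendsto (fun n => Polynomial.aeval (ContinuousMap.id ℂ) (P n)) atTop (𝓝 f) := by
  have hs := (hf.hasFPowerSeriesOnBall 0 (R := 1) one_pos).tendstoLocallyUniformlyOn
  set p := cauchyPowerSeries f 0 (1 : NNReal)
  refine ⟨fun n => ∑ k ∈ Finset.range n, Polynomial.C (p.coeff k) * Polynomial.X ^ k, ?_⟩
  rw [ContinuousMap.tendsto_iff_tendstoLocallyUniformly, ← tendstoLocallyUniformlyOn_univ]
  rw [Metric.eball_top] at hs
  simp only [zero_add] at hs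
  refine hs.congr fun n z _ => ?_
  simp only [FormalMultilinearSeries.partialSum, FormalMultilinearSeries.apply_eq_pow_smul_coeff]
  rw [Polynomial.aeval_continuousMap_apply, Polynomial.eval_finsetSum]
  refine Finset.sum_congr rfl fun k _ => ?_
  rw [smul_eq_mul, Polynomial.eval_C_mul, Polynomial.eval_pow, Polynomial.eval_X,
    ContinuousMap.id_apply, mul_comm]

/-- Every entire function is a limit of polynomials, of bounded degree, in `exp (ε z)`, as
`ε → 0`. -/
lemma eventually_aeval_expMap_mem {U : Set C(ℂ, ℂ)} (hU : IsOpen U) {f : C(ℂ, ℂ)} (hfU : f ∈ U)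
    (hf : Differentiable ℂ f) :
    ∃ K : ℕ, ∀ᶠ ε in 𝓝[≠] (0 : ℂ), ∃ q : Polynomial ℂ, q.natDegree ≤ K ∧
      Polynomial.aeval (expMap ε) q ∈ U := by
  obtain ⟨P, hP⟩ := continuousMap_tendsto_taylor f hf
  obtain ⟨n, hn⟩ := (hP.eventually (hU.mem_nhds hfU)).exists
  have hd : Continuous (dslope Complex.exp 0) := by
    have : ContinuousOn (dslope Complex.exp 0) univ :=
      ((Complex.differentiableOn_dslope univ_mem).2
        Complex.differentiable_exp.differentiableOn).continuousOn
    rwa [continuousOn_univ] at this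
  let G : C(ℂ × ℂ, ℂ) :=
    ⟨fun x => (P n).eval (x.2 * dslope Complex.exp 0 (x.1 * x.2)), by fun_prop⟩
  have hG0 : G.curry 0 ∈ U := by
    convert hn using 1
    refine eq_iff_iff.1 (congrArg (fun g => g ∈ U) (ContinuousMap.ext fun z => ?_))
    simp [G, Polynomial.aeval_continuousMap_apply, dslope_same]
  refine ⟨(P n).natDegree, ?_⟩
  have hev : ∀ᶠ ε in 𝓝[≠] (0 : ℂ), G.curry ε ∈ U :=
    (G.curry.continuous.continuousAt.eventually (hU.mem_nhds hG0)).filter_mono nhdsWithin_le_nhds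
  filter_upwards [hev, self_mem_nhdsWithin] with ε hε hne
  refine ⟨(P n).comp (Polynomial.C ε⁻¹ * (Polynomial.X - Polynomial.C 1)), ?_, ?_⟩
  · refine Polynomial.natDegree_comp_le.trans ?_
    have : (Polynomial.C ε⁻¹ * (Polynomial.X - Polynomial.C 1)).natDegree ≤ 1 :=
      (Polynomial.natDegree_C_mul_le _ _).trans (Polynomial.natDegree_X_sub_C_le 1)
    nlinarith
  · have key : Polynomial.aeval (expMap ε) (Polynomial.C ε⁻¹ * (Polynomial.X - Polynomial.C 1))
        = ⟨fun z => z * dslope Complex.exp 0 (ε * z), by fun_prop⟩ := by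
      ext z
      have := sub_smul_dslope Complex.exp 0 (ε * z)
      simp only [sub_zero, Complex.exp_zero, smul_eq_mul] at this
      have hne' : ε ≠ 0 := hne
      simp [expMap, ← this, Algebra.algebraMap_eq_smul_one]
      field_simp
    rw [Polynomial.aeval_comp, key]
    convert hε using 1
    refine ContinuousMap.ext fun z => ?_
    simp [G, Polynomial.aeval_continuousMap_apply]

/-! ### Size of the symbol -/

lemma norm_symbol_sq (a x y : ℝ) : ‖symbol a (x + y * Complex.I)‖ ^ 2 =
    (Real.exp x ^ 2 + a ^ 2) - 2 * a * Real.exp x * Real.cos y := by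
  rw [← Complex.normSq_eq_norm_sq, Complex.normSq_apply, symbol]
  simp only [Complex.sub_re, Complex.sub_im, Complex.exp_re, Complex.exp_im, Complex.add_re,
    Complex.add_im, Complex.re_ofReal_mul, Complex.im_ofReal_mul, Complex.I_re, Complex.I_im,
    Complex.ofReal_re, Complex.ofReal_im, mul_zero, mul_one, add_zero, zero_add, sub_zero]
  linear_combination Real.exp x ^ 2 * Real.sin_sq_add_cos_sq y

lemma one_lt_norm_symbol {a x : ℝ} (ha : 0 < a) (hx : 1 + a < Real.exp x) (y : ℝ) :
    1 < ‖symbol a (x + y * Complex.I)‖ := by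
  have h := norm_symbol_sq a x y
  have : 1 < ‖symbol a (x + y * Complex.I)‖ ^ 2 := by
    rw [h]
    nlinarith [mul_nonneg (mul_pos ha (Real.exp_pos x)).le (sub_nonneg.2 (Real.cos_le_one y))]
  nlinarith [norm_nonneg (symbol a (x + y * Complex.I))]

lemma exists_norm_symbol_lt_one {a : ℝ} (ha₀ : 0 < a) (ha₁ : a ≤ 1) {b : ℝ}
    (hb : Real.exp b < 1 + a) :
    ∃ η > 0, ∀ y : ℝ, |y| < η → ∀ x ≤ b, ‖symbol a (x + y * Complex.I)‖ < 1 := by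
  set t := Real.exp b with ht
  have ht0 : 0 < t := Real.exp_pos b
  have hc : ∀ᶠ y in 𝓝 (0 : ℝ), t ^ 2 + a ^ 2 - 2 * a * t * Real.cos y < 1 ∨
      t - 2 * a * Real.cos y < 0 := by
    have h1 : Continuous fun y : ℝ => t ^ 2 + a ^ 2 - 2 * a * t * Real.cos y := by fun_prop
    have h2 : Continuous fun y : ℝ => t - 2 * a * Real.cos y := by fun_prop
    by_cases h : t - 2 * a < 0
    · exact ((h2.tendsto 0).eventually_lt_const (by simpa using h)).mono fun y => Or.inr
    · refine ((h1.tendsto 0).eventually_lt_const ?_).mono fun y => Or.inl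
      simp only [Real.cos_zero]
      push Not at h
      nlinarith
  obtain ⟨η, hη, H⟩ := Metric.eventually_nhds_iff.1 hc
  refine ⟨η, hη, fun y hy x hx => ?_⟩
  have hs : Real.exp x ≤ t := Real.exp_le_exp.2 hx
  have hs0 : 0 < Real.exp x := Real.exp_pos x
  have : ‖symbol a (x + y * Complex.I)‖ ^ 2 < 1 := by
    rw [norm_symbol_sq]
    set s := Real.exp x
    have ha2 : a ^ 2 ≤ 1 := by nlinarith
    rcases le_or_gt 0 (t - 2 * a * Real.cos y) with h0 | h0
    · rcases H (by simpa using hy) with h | h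
      · nlinarith [mul_nonneg (sub_nonneg.2 hs) h0, mul_nonneg hs0.le (sub_nonneg.2 hs)]
      · linarith
    · nlinarith [mul_pos hs0 (neg_pos.2 h0), mul_nonneg hs0.le (sub_nonneg.2 hs)]
  nlinarith [norm_nonneg (symbol a (x + y * Complex.I))]

/-- The logarithm of the modulus of the symbol is strictly convex on short vertical segments. -/
lemma exists_strictConvexOn_log_norm_symbol {a x : ℝ} (ha : 0 < a) (hx : 1 + a < Real.exp x) :
    ∃ η > 0, StrictConvexOn ℝ (Ioo (-η) η)
      (fun y : ℝ => Real.log (‖symbol a (x + y * Complex.I)‖ ^ 2)) := by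
  set A := Real.exp x ^ 2 + a ^ 2 with hA
  set B := 2 * a * Real.exp x with hB
  have hB0 : 0 < B := by positivity
  have hAB : B < A := by nlinarith
  have hpos : ∀ y : ℝ, 0 < A - B * Real.cos y := fun y => by
    nlinarith [mul_nonneg hB0.le (sub_nonneg.2 (Real.cos_le_one y))]
  have hc : ∀ᶠ y in 𝓝 (0 : ℝ), 0 < A * Real.cos y - B :=
    ((by fun_prop : Continuous fun y : ℝ => A * Real.cos y - B).tendsto 0).eventually_const_lt
      (by simpa using hAB)
  obtain ⟨η, hη, H⟩ := Metric.eventually_nhds_iff.1 hc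
  refine ⟨η, hη, ?_⟩
  simp only [norm_symbol_sq]
  rw [← hA, ← hB]
  have hq : ∀ y : ℝ, HasDerivAt (fun y : ℝ => A - B * Real.cos y) (B * Real.sin y) y := fun y => by
    simpa using ((Real.hasDerivAt_cos y).const_mul B).const_sub A
  have hd1 : deriv (fun y : ℝ => Real.log (A - B * Real.cos y)) =
      fun y => B * Real.sin y / (A - B * Real.cos y) := by
    ext y
    exact ((hq y).log (hpos y).ne').deriv
  have hd2 : ∀ y : ℝ, deriv (fun y => B * Real.sin y / (A - B * Real.cos y)) y =
      B * (A * Real.cos y - B) / (A - B * Real.cos y) ^ 2 := fun y => by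
    refine (((Real.hasDerivAt_sin y).const_mul B).fun_div (hq y) (hpos y).ne').deriv.trans ?_
    congr 1
    linear_combination - B ^ 2 * Real.sin_sq_add_cos_sq y
  refine strictConvexOn_of_deriv2_pos' (convex_Ioo _ _) ?_ fun y hy => ?_
  · exact (Continuous.log (by fun_prop) fun y => (hpos y).ne').continuousOn
  · simp only [Function.iterate_succ, Function.iterate_zero, Function.comp_apply, id, hd1, hd2]
    have := H (show dist y 0 < η by rw [Real.dist_0_eq_abs]; exact abs_lt.2 hy)
    have := hpos y
    positivity

/-- Strict log-convexity makes the off-diagonal terms of a product of roots contracting. -/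
lemma norm_prod_mul_symbol_lt_one {a x : ℝ} {s : Set ℝ} {m : ℕ}
    (hs : StrictConvexOn ℝ s (fun y : ℝ => Real.log (‖symbol a (x + y * Complex.I)‖ ^ 2)))
    (r : Fin m → ℂ) (y : Fin m → ℝ) (hr : ∀ i, r i ^ m * symbol a (x + y i * Complex.I) = 1)
    (hy : ∀ i, y i ∈ s) (hne : ∃ i j, y i ≠ y j) :
    ‖(∏ i, r i) * symbol a (∑ i, (x + y i * Complex.I) / m)‖ < 1 := by
  obtain ⟨i₀, j₀, hij⟩ := hne
  have hm : 0 < m := i₀.pos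
  have hmR : (0 : ℝ) < m := by exact_mod_cast hm
  have hmC : (m : ℂ) ≠ 0 := by exact_mod_cast hm.ne'
  have hlt := hs.map_sum_lt (t := Finset.univ) (w := fun _ : Fin m => (m : ℝ)⁻¹) (p := y)
    (fun i _ => by positivity) (by simp [hmR.ne']) (fun i _ => hy i)
    ⟨i₀, Finset.mem_univ _, j₀, Finset.mem_univ _, hij⟩
  have havg : ∑ i, (x + y i * Complex.I) / (m : ℂ) =
      x + ((∑ i, (m : ℝ)⁻¹ • y i : ℝ) : ℂ) * Complex.I := by
    simp only [add_div, Finset.sum_add_distrib, Finset.sum_const, Finset.card_univ,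
      Fintype.card_fin, nsmul_eq_mul, smul_eq_mul, Complex.ofReal_sum, Finset.sum_mul]
    congr 1
    · field_simp
    · refine Finset.sum_congr rfl fun i _ => ?_
      push_cast
      field_simp
  rw [havg]
  set w := symbol a (x + ((∑ i, (m : ℝ)⁻¹ • y i : ℝ) : ℂ) * Complex.I)
  rcases eq_or_ne w 0 with hw | hw
  · simp [hw]
  have hφ : ∀ i, symbol a (x + y i * Complex.I) ≠ 0 := fun i h => by
    simpa [h] using hr i
  have hpos : ∀ i, 0 < ‖symbol a (x + y i * Complex.I)‖ ^ 2 := fun i =>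
    pow_pos (norm_pos_iff.2 (hφ i)) 2
  have hlog : Real.log ((‖w‖ ^ 2) ^ m) <
      Real.log (∏ i, ‖symbol a (x + y i * Complex.I)‖ ^ 2) := by
    rw [Real.log_pow, Real.log_prod fun i _ => (hpos i).ne']
    rw [← Finset.smul_sum, smul_eq_mul, inv_mul_eq_div, lt_div_iff₀ hmR] at hlt
    rwa [mul_comm]
  have hprod : (‖w‖ ^ 2) ^ m < ∏ i, ‖symbol a (x + y i * Complex.I)‖ ^ 2 :=
    (Real.log_lt_log_iff (pow_pos (pow_pos (norm_pos_iff.2 hw) 2) m)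
      (Finset.prod_pos fun i _ => hpos i)).1 hlog
  have hone : (‖∏ i, r i‖ ^ 2) ^ m * ∏ i, ‖symbol a (x + y i * Complex.I)‖ ^ 2 = 1 := by
    rw [norm_prod, ← Finset.prod_pow, ← Finset.prod_pow, ← Finset.prod_mul_distrib]
    refine Finset.prod_eq_one fun i _ => ?_
    have := congrArg (fun z => ‖z‖ ^ 2) (hr i)
    simp only [norm_mul, norm_pow, norm_one, one_pow] at this
    rw [← this]; ring
  have hr0 : 0 < (‖∏ i, r i‖ ^ 2) ^ m := by
    have : ∏ i, r i ≠ 0 := Finset.prod_ne_zero_iff.2 fun i _ h => by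
      simpa [h, hm.ne'] using hr i
    positivity
  by_contra! hcon
  rw [norm_mul] at hcon
  have h1 : 1 ≤ ((‖∏ i, r i‖ * ‖w‖) ^ 2) ^ m := one_le_pow₀ (one_le_pow₀ hcon)
  rw [mul_pow, mul_pow] at h1
  nlinarith [mul_lt_mul_of_pos_left hprod hr0]

/-! ### Small perturbations with controlled powers -/

/-- The exponential sum with frequencies `μ k` and coefficients `c k * ρ k ^ N`. -/
def expSum (s : Finset ℕ) (c ρ μ : ℕ → ℂ) (N : ℕ) : C(ℂ, ℂ) :=
  ∑ k ∈ s, (c k * ρ k ^ N) • expMap (μ k)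

lemma expSum_pow (s : Finset ℕ) (c ρ μ : ℕ → ℂ) (N l : ℕ) :
    expSum s c ρ μ N ^ l = ∑ p ∈ Fintype.piFinset fun _ : Fin l => s,
      ((∏ i, c (p i)) * (∏ i, ρ (p i)) ^ N) • expMap (∑ i, μ (p i)) := by
  rw [expSum, Finset.sum_pow']
  refine Finset.sum_congr rfl fun p _ => ?_
  rw [← Finset.prod_pow, ← Finset.prod_mul_distrib, ← prod_expMap, Finset.prod_smul]

lemma differentiable_expSum (s : Finset ℕ) (c ρ μ : ℕ → ℂ) (N : ℕ) :
    Differentiable ℂ (expSum s c ρ μ N) := by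
  have : (expSum s c ρ μ N : ℂ → ℂ) = fun z => ∑ k ∈ s, (c k * ρ k ^ N) * expMap (μ k) z := by
    ext z; simp [expSum, ContinuousMap.sum_apply]
  rw [this]
  exact Differentiable.fun_sum fun k _ => (differentiable_expMap _).const_mul _

lemma tendsto_expSum (s : Finset ℕ) (c ρ μ : ℕ → ℂ) (hρ : ∀ k ∈ s, ‖ρ k‖ < 1) :
    Tendsto (expSum s c ρ μ) atTop (𝓝 0) := by
  have : Tendsto (expSum s c ρ μ) atTop (𝓝 (∑ k ∈ s, (c k * 0 : ℂ) • expMap (μ k))) :=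
    tendsto_finsetSum _ fun k hk =>
      ((tendsto_pow_atTop_nhds_zero_of_norm_lt_one (hρ k hk)).const_mul (c k)).smul_const
        (expMap (μ k))
  refine this.trans (le_of_eq ?_)
  congr 1
  exact Finset.sum_eq_zero fun k _ => by rw [mul_zero]; exact zero_smul ℂ (expMap (μ k))

lemma tendsto_expSum_pow_mul_aeval (a : ℝ) {s : Finset ℕ} {c ρ μ : ℕ → ℂ} {l : ℕ} {ν : ℂ}
    (h : ∀ p ∈ Fintype.piFinset fun _ : Fin l => s, ∀ k : ℕ,
      ‖(∏ i, ρ (p i)) * symbol a (∑ i, μ (p i) + k * ν)‖ < 1) (q : Polynomial ℂ) :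
    Tendsto (fun N => (shiftOp a ^ N) (expSum s c ρ μ N ^ l * Polynomial.aeval (expMap ν) q))
      atTop (𝓝 0) := by
  have hsum : ∀ N, (shiftOp a ^ N) (expSum s c ρ μ N ^ l * Polynomial.aeval (expMap ν) q) =
      ∑ p ∈ Fintype.piFinset fun _ : Fin l => s, ∑ k ∈ Finset.range (q.natDegree + 1),
        (shiftOp a ^ N) ((((∏ i, c (p i)) * q.coeff k) * (∏ i, ρ (p i)) ^ N) •
          expMap (∑ i, μ (p i) + k * ν)) := fun N => by
    rw [expSum_pow, Polynomial.aeval_eq_sum_range, Finset.sum_mul_sum, map_sum]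
    refine Finset.sum_congr rfl fun p _ => ?_
    rw [map_sum]
    refine Finset.sum_congr rfl fun k _ => ?_
    rw [expMap_pow, expMap_add, smul_mul_smul_comm]
    congr 2
    ring
  simp only [hsum]
  have := tendsto_finsetSum (Fintype.piFinset fun _ : Fin l => s) fun p hp =>
    tendsto_finsetSum (Finset.range (q.natDegree + 1)) fun k _ =>
      tendsto_shiftOp_pow_smul_expMap a ((∏ i, c (p i)) * q.coeff k) _ _ (h p hp k)
  simpa using this

lemma tendsto_expSum_pow_diag (a : ℝ) {s : Finset ℕ} {c ρ μ : ℕ → ℂ} {m : ℕ} (hm : 0 < m)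
    (hdiag : ∀ k ∈ s, ρ k ^ m * symbol a (m * μ k) = 1)
    (hoff : ∀ p ∈ Fintype.piFinset fun _ : Fin m => s, (∃ i j, p i ≠ p j) →
      ‖(∏ i, ρ (p i)) * symbol a (∑ i, μ (p i))‖ < 1) :
    Tendsto (fun N => (shiftOp a ^ N) (expSum s c ρ μ N ^ m)) atTop
      (𝓝 (∑ k ∈ s, c k ^ m • expMap (m * μ k))) := by
  classical
  have hterm : ∀ p ∈ Fintype.piFinset fun _ : Fin m => s,
      Tendsto (fun N => (shiftOp a ^ N)
        (((∏ i, c (p i)) * (∏ i, ρ (p i)) ^ N) • expMap (∑ i, μ (p i)))) atTop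
        (𝓝 (if p = fun _ => p ⟨0, hm⟩ then
          c (p ⟨0, hm⟩) ^ m • expMap (m * μ (p ⟨0, hm⟩)) else 0)) := fun p hp => by
    split_ifs with hconst
    · have hk := Fintype.mem_piFinset.1 hp ⟨0, hm⟩
      generalize p ⟨0, hm⟩ = k at hconst hk
      subst hconst
      refine tendsto_const_nhds.congr fun N => ?_
      simp only [Finset.prod_const, Finset.sum_const, Finset.card_univ, Fintype.card_fin,
        nsmul_eq_mul]
      rw [map_smul, shiftOp_pow_expMap, smul_smul, mul_assoc, ← mul_pow, hdiag k hk, one_pow,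
        mul_one]
    · refine tendsto_shiftOp_pow_smul_expMap a _ _ _ (hoff p hp ?_)
      by_contra! hcon
      exact hconst (funext fun i => hcon i _)
  have hlim := tendsto_finsetSum _ hterm
  have hsum : (∑ p ∈ Fintype.piFinset fun _ : Fin m => s, if p = fun _ => p ⟨0, hm⟩ then
      c (p ⟨0, hm⟩) ^ m • expMap (m * μ (p ⟨0, hm⟩)) else 0) =
      ∑ k ∈ s, c k ^ m • expMap (m * μ k) := by
    rw [← Finset.sum_filter]
    refine Finset.sum_nbij' (fun p => p ⟨0, hm⟩) (fun k _ => k) ?_ ?_ ?_ ?_ ?_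
    · intro p hp
      exact Fintype.mem_piFinset.1 (Finset.mem_filter.1 hp).1 _
    · intro k hk
      simp [hk]
    · intro p hp
      exact (Finset.mem_filter.1 hp).2.symm
    · intro k _
      rfl
    · intro p _
      rfl
  rw [hsum] at hlim
  refine hlim.congr fun N => ?_
  rw [expSum_pow, map_sum]

lemma tendsto_shiftOp_pow_sum (a : ℝ) {m : ℕ} {R : ℕ → C(ℂ, ℂ)} {ν : ℂ}
    (h : ∀ l < m, ∀ q : Polynomial ℂ,
      Tendsto (fun N => (shiftOp a ^ N) (R N ^ l * Polynomial.aeval (expMap ν) q)) atTop (𝓝 0))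
    (q : Polynomial ℂ) (j : ℕ) {n : ℕ} (hn : n ≤ m) :
    Tendsto (fun N => (shiftOp a ^ N) (∑ l ∈ Finset.range n,
      R N ^ l * Polynomial.aeval (expMap ν) q ^ (j - l) * (j.choose l : C(ℂ, ℂ)))) atTop (𝓝 0) := by
  have hlim := tendsto_finsetSum (Finset.range n) fun l hl =>
    h l ((Finset.mem_range.1 hl).trans_le hn) (q ^ (j - l) * (j.choose l : Polynomial ℂ))
  rw [Finset.sum_const_zero] at hlim
  refine hlim.congr fun N => ?_
  rw [map_sum]
  refine Finset.sum_congr rfl fun l _ => ?_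
  rw [map_mul (Polynomial.aeval _), map_pow (Polynomial.aeval _), map_natCast (Polynomial.aeval _),
    mul_assoc]

/-- Transitivity property underlying the hypercyclic algebra: some `h ∈ U` has `h ^ m` sent into
`V` and all its lower powers sent into `W` by a common power of the operator. -/
lemma exists_pow_mem {a : ℝ} (ha₀ : 0 < a) (ha₁ : a ≤ 1) {m : ℕ} (hm : 0 < m)
    {U V W : Set C(ℂ, ℂ)} (hU : IsOpen U) (hV : IsOpen V) (hW : IsOpen W) {f g : C(ℂ, ℂ)}
    (hfU : f ∈ U) (hf : Differentiable ℂ f) (hgV : g ∈ V) (hg : Differentiable ℂ g)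
    (h0 : (0 : C(ℂ, ℂ)) ∈ W) :
    ∃ h ∈ U, Differentiable ℂ h ∧
      ∃ N : ℕ, (shiftOp a ^ N) (h ^ m) ∈ V ∧ ∀ j < m, (shiftOp a ^ N) (h ^ j) ∈ W := by
  have hmR : (1 : ℝ) ≤ m := by exact_mod_cast hm
  have hmC : (m : ℂ) ≠ 0 := by exact_mod_cast hm.ne'
  set L := Real.log (1 + a) with hL
  have hL0 : 0 < L := Real.log_pos (by linarith)
  have hexpL : Real.exp L = 1 + a := Real.exp_log (by linarith)
  set x := L * (m / (m - 1 / 2)) with hx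
  have hxL : L < x := by
    have : 1 < (m : ℝ) / (m - 1 / 2) := by rw [one_lt_div] <;> linarith
    nlinarith
  have hx0 : 0 < x := hL0.trans hxL
  have hx1 : 1 + a < Real.exp x := by rw [← hexpL]; exact Real.exp_lt_exp.2 hxL
  set b := x * ((m - 1) / m) with hb
  have hbL : Real.exp b < 1 + a := by
    rw [← hexpL, Real.exp_lt_exp]
    have : b = L * ((m - 1) / (m - 1 / 2)) := by
      rw [hb, hx]; field_simp
    rw [this]
    have : ((m : ℝ) - 1) / (m - 1 / 2) < 1 := by rw [div_lt_one] <;> linarith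
    nlinarith
  obtain ⟨η₁, hη₁, hconv⟩ := exists_strictConvexOn_log_norm_symbol ha₀ hx1
  obtain ⟨η₂, hη₂, hsmall⟩ := exists_norm_symbol_lt_one ha₀ ha₁ hbL
  -- approximation in `U`
  obtain ⟨δ, hδ, q, hq⟩ : ∃ δ > (0 : ℝ), ∃ q : Polynomial ℂ,
      Polynomial.aeval (expMap (-δ : ℝ)) q ∈ U := by
    obtain ⟨K, hK⟩ := eventually_aeval_expMap_mem hU hfU hf
    have ht : Tendsto (fun δ : ℝ => ((-δ : ℝ) : ℂ)) (𝓝[>] 0) (𝓝[≠] 0) := by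
      refine tendsto_nhdsWithin_iff.2 ⟨?_, ?_⟩
      · have : Continuous fun δ : ℝ => ((-δ : ℝ) : ℂ) := by fun_prop
        simpa using (this.tendsto 0).mono_left nhdsWithin_le_nhds
      · filter_upwards [self_mem_nhdsWithin] with δ hδ
        simpa using (ne_of_gt hδ : δ ≠ 0)
    obtain ⟨δ, ⟨q, -, hq⟩, hδ⟩ := ((ht.eventually hK).and self_mem_nhdsWithin).exists
    exact ⟨δ, hδ, q, hq⟩
  -- approximation in `V`
  obtain ⟨K, ε, r, hε, hεK₁, hεK₂, hrK, hr⟩ : ∃ (K : ℕ) (ε : ℝ) (r : Polynomial ℂ), 0 < ε ∧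
      ε * K < η₁ ∧ ε * K < η₂ ∧ r.natDegree ≤ K ∧
      expMap x * Polynomial.aeval (expMap (ε * Complex.I)) r ∈ V := by
    have hV' : IsOpen {h : C(ℂ, ℂ) | expMap x * h ∈ V} := hV.preimage (continuous_const_mul _)
    obtain ⟨K, hK⟩ := eventually_aeval_expMap_mem hV' (f := expMap (-x) * g)
      (by simpa [← mul_assoc, ← expMap_add, expMap_zero] using hgV)
      ((differentiable_expMap _).mul hg)
    have ht : Tendsto (fun ε : ℝ => (ε * Complex.I : ℂ)) (𝓝[>] 0) (𝓝[≠] 0) := by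
      refine tendsto_nhdsWithin_iff.2 ⟨?_, ?_⟩
      · have : Continuous fun ε : ℝ => (ε * Complex.I : ℂ) := by fun_prop
        simpa using (this.tendsto 0).mono_left nhdsWithin_le_nhds
      · filter_upwards [self_mem_nhdsWithin] with ε hε
        simpa using (ne_of_gt hε : ε ≠ 0)
    have hlim : Tendsto (fun ε : ℝ => ε * K) (𝓝[>] 0) (𝓝 0) := by
      have : Continuous fun ε : ℝ => ε * K := by fun_prop
      simpa using (this.tendsto 0).mono_left nhdsWithin_le_nhds
    obtain ⟨ε, ⟨⟨⟨r, hrK, hr⟩, h1⟩, h2⟩, hε⟩ := ((((ht.eventually hK).and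
      (hlim.eventually_lt_const hη₁)).and (hlim.eventually_lt_const hη₂)).and
      self_mem_nhdsWithin).exists
    exact ⟨K, ε, r, hε, h1, h2, hrK, hr⟩
  set y : ℕ → ℝ := fun k => ε * k with hy
  have hyK : ∀ k ∈ Finset.range (K + 1), 0 ≤ y k ∧ y k ≤ ε * K := fun k hk => by
    have : (k : ℝ) ≤ K := by exact_mod_cast Nat.lt_succ_iff.1 (Finset.mem_range.1 hk)
    exact ⟨by positivity, mul_le_mul_of_nonneg_left this hε.le⟩
  choose c hc using fun k => IsAlgClosed.exists_pow_nat_eq (r.coeff k) hm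
  choose ρ hρ using fun k =>
    IsAlgClosed.exists_pow_nat_eq (symbol a (x + y k * Complex.I))⁻¹ hm
  have hφ1 : ∀ k, 1 < ‖symbol a (x + y k * Complex.I)‖ := fun k => one_lt_norm_symbol ha₀ hx1 _
  have hρφ : ∀ k, ρ k ^ m * symbol a (x + y k * Complex.I) = 1 := fun k => by
    rw [hρ, inv_mul_cancel₀]
    exact norm_pos_iff.1 (one_pos.trans (hφ1 k))
  have hρ1 : ∀ k, ‖ρ k‖ < 1 := fun k => by
    by_contra! hcon
    have h1 := congrArg norm (hρφ k)
    rw [norm_mul, norm_pow, norm_one] at h1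
    nlinarith [one_le_pow₀ (n := m) hcon, hφ1 k]
  set μ : ℕ → ℂ := fun k => (x + y k * Complex.I) / m with hμ
  set s := Finset.range (K + 1)
  set R := expSum s c ρ μ
  set u := Polynomial.aeval (expMap (-δ : ℝ)) q with hu
  have hlow : ∀ l < m, ∀ q : Polynomial ℂ, Tendsto (fun N => (shiftOp a ^ N)
      (R N ^ l * Polynomial.aeval (expMap (-δ : ℝ)) q)) atTop (𝓝 0) := by
    refine fun l hl q => tendsto_expSum_pow_mul_aeval a (fun p hp k => ?_) q
    have hlm : (l : ℝ) ≤ m - 1 := by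
      have : (l : ℝ) + 1 ≤ m := by exact_mod_cast hl
      linarith
    have hexp : ∑ i, μ (p i) + k * ((-δ : ℝ) : ℂ) =
        ((x * (l / m) - k * δ : ℝ) : ℂ) + ((∑ i, y (p i) / m : ℝ) : ℂ) * Complex.I := by
      simp only [hμ, add_div, Finset.sum_add_distrib, Finset.sum_const, Finset.card_univ,
        Fintype.card_fin, nsmul_eq_mul, Complex.ofReal_sum, Finset.sum_mul]
      push_cast
      have : ∀ i, (y (p i) : ℂ) * Complex.I / m = y (p i) / m * Complex.I := fun i => by ring
      simp only [this]
      ring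
    have hsym : ‖symbol a (∑ i, μ (p i) + k * ((-δ : ℝ) : ℂ))‖ < 1 := by
      rw [hexp]
      refine hsmall _ ?_ _ ?_
      · have hyp := fun i => hyK (p i) (Fintype.mem_piFinset.1 hp i)
        rw [abs_of_nonneg (Finset.sum_nonneg fun i _ => div_nonneg (hyp i).1 (by positivity))]
        calc ∑ i, y (p i) / m ≤ ∑ _i : Fin l, ε * K / m :=
              Finset.sum_le_sum fun i _ => div_le_div_of_nonneg_right (hyp i).2 (by positivity)
          _ = (ε * K) * (l / m) := by simp; ring
          _ ≤ (ε * K) * 1 := by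
              refine mul_le_mul_of_nonneg_left ?_ (by positivity)
              rw [div_le_one] <;> linarith
          _ < η₂ := by rwa [mul_one]
      · have h1 : (l : ℝ) / m ≤ (m - 1) / m := div_le_div_of_nonneg_right hlm (by positivity)
        have h2 : 0 ≤ (k : ℝ) * δ := by positivity
        nlinarith
    rw [norm_mul, norm_prod]
    exact mul_lt_one_of_nonneg_of_lt_one_right
      (Finset.prod_le_one (fun _ _ => norm_nonneg _) fun i _ => (hρ1 _).le) (norm_nonneg _) hsym
  have htop : Tendsto (fun N => (shiftOp a ^ N) (R N ^ m)) atTop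
      (𝓝 (expMap x * Polynomial.aeval (expMap (ε * Complex.I)) r)) := by
    have hmμ : ∀ k, m * μ k = x + y k * Complex.I := fun k => mul_div_cancel₀ _ hmC
    have := tendsto_expSum_pow_diag a (s := s) (c := c) (ρ := ρ) (μ := μ) hm
      (fun k _ => by rw [hmμ, hρφ]) fun p hp ⟨i, j, hij⟩ => by
        refine norm_prod_mul_symbol_lt_one hconv (fun i => ρ (p i)) (fun i => y (p i))
          (fun i => hρφ _) (fun i => ?_) ⟨i, j, fun h => hij ?_⟩
        · have := hyK (p i) (Fintype.mem_piFinset.1 hp i)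
          exact ⟨by linarith, by linarith⟩
        · exact_mod_cast mul_left_cancel₀ hε.ne' h
    convert this using 2
    rw [Polynomial.aeval_eq_sum_range' (Nat.lt_succ_of_le hrK), Finset.mul_sum]
    refine Finset.sum_congr rfl fun k _ => ?_
    rw [hc, hmμ, expMap_add, expMap_pow, mul_smul_comm]
    congr 3
    simp only [hy]
    push_cast
    ring
  have hbinom : ∀ N j, (R N + u) ^ j = ∑ l ∈ Finset.range (j + 1),
      R N ^ l * u ^ (j - l) * (j.choose l : C(ℂ, ℂ)) := fun N j => add_pow _ _ _
  have hUlim : ∀ᶠ N in atTop, R N + u ∈ U := by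
    have : Tendsto (fun N => R N + u) atTop (𝓝 (0 + u)) :=
      (tendsto_expSum s c ρ μ fun k _ => hρ1 k).add_const u
    rw [zero_add] at this
    exact this.eventually (hU.mem_nhds hq)
  have hVlim : ∀ᶠ N in atTop, (shiftOp a ^ N) ((R N + u) ^ m) ∈ V := by
    have := (tendsto_shiftOp_pow_sum a hlow q m le_rfl).add htop
    rw [zero_add] at this
    filter_upwards [this.eventually (hV.mem_nhds hr)] with N hN
    rw [hbinom, Finset.sum_range_succ, map_add, Nat.sub_self, pow_zero, mul_one, Nat.choose_self,
      Nat.cast_one, mul_one]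
    exact hN
  have hWlim : ∀ᶠ N in atTop, ∀ j ∈ Finset.range m, (shiftOp a ^ N) ((R N + u) ^ j) ∈ W := by
    rw [eventually_all_finset]
    intro j hj
    have := tendsto_shiftOp_pow_sum a hlow q j (Nat.succ_le_of_lt (Finset.mem_range.1 hj))
    filter_upwards [this.eventually (hW.mem_nhds h0)] with N hN
    rw [hbinom]
    exact hN
  obtain ⟨N, ⟨hN1, hN2⟩, hN3⟩ := ((hUlim.and hVlim).and hWlim).exists
  refine ⟨R N + u, hN1, ?_, N, hN2, fun j hj => hN3 j (Finset.mem_range.2 hj)⟩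
  refine (differentiable_expSum s c ρ μ N).add ?_
  have hu' : (u : ℂ → ℂ) = fun z => q.eval (expMap (-δ : ℝ) z) := by
    ext z; rw [hu, Polynomial.aeval_continuousMap_apply]
  rw [hu']
  exact q.differentiable.comp (differentiable_expMap _)

/-! ### Baire category -/

lemma isClosed_setOf_differentiable : IsClosed {f : C(ℂ, ℂ) | Differentiable ℂ f} := by
  refine IsSeqClosed.isClosed fun F f hF hlim => ?_
  rw [ContinuousMap.tendsto_iff_tendstoLocallyUniformly, ← tendstoLocallyUniformlyOn_univ] at hlim
  exact differentiableOn_univ.1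
    (hlim.differentiableOn (.of_forall fun n => (hF n).differentiableOn) isOpen_univ)

lemma baireSpace_entire : BaireSpace Entire := by
  have : TopologicalSpace.IsCompletelyPseudoMetrizableSpace Entire :=
    isClosed_setOf_differentiable.isClosedEmbedding_subtypeVal.IsCompletelyPseudoMetrizableSpace
  infer_instance

/-- Entire functions whose powers behave independently along the orbit: for each degree `m` and
each target, the `m`-th power is sent to the target while the lower powers are sent to `0`. -/
lemma exists_entire_pow_mem {a : ℝ} (ha₀ : 0 < a) (ha₁ : a ≤ 1) :
    ∃ f : Entire, f ≠ 0 ∧ ∀ m > 0, ∀ g : C(ℂ, ℂ), Differentiable ℂ g →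
      ∀ V ∈ 𝓝 g, ∀ W ∈ 𝓝 (0 : C(ℂ, ℂ)),
        ∃ N : ℕ, (shiftOp a ^ N) (f.1 ^ m) ∈ V ∧ ∀ j < m, (shiftOp a ^ N) (f.1 ^ j) ∈ W := by
  have := baireSpace_entire
  set B := TopologicalSpace.countableBasis C(ℂ, ℂ)
  have hB : TopologicalSpace.IsTopologicalBasis B := TopologicalSpace.isBasis_countableBasis _
  set S : Set (ℕ × Set C(ℂ, ℂ) × Set C(ℂ, ℂ)) :=
    {t | 0 < t.1 ∧ t.2.1 ∈ B ∧ t.2.2 ∈ B ∧ (0 : C(ℂ, ℂ)) ∈ t.2.2 ∧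
      ∃ g ∈ t.2.1, Differentiable ℂ g}
  have hS : S.Countable := by
    have hBc : B.Countable := TopologicalSpace.countable_countableBasis _
    refine ((countable_univ (α := ℕ)).prod (hBc.prod hBc)).mono ?_
    rintro t ⟨-, h1, h2, -⟩
    exact ⟨mem_univ _, h1, h2⟩
  set O : ℕ × Set C(ℂ, ℂ) × Set C(ℂ, ℂ) → Set Entire := fun t =>
    ⋃ N : ℕ, (fun f : Entire => (shiftOp a ^ N) (f.1 ^ t.1)) ⁻¹' t.2.1 ∩
      ⋂ j ∈ Finset.range t.1, (fun f : Entire => (shiftOp a ^ N) (f.1 ^ j)) ⁻¹' t.2.2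
  have hcont : ∀ N j : ℕ, Continuous fun f : Entire => (shiftOp a ^ N) (f.1 ^ j) := fun N j =>
    (shiftOp a ^ N).continuous.comp (continuous_subtype_val.pow j)
  have hO : ∀ t ∈ S, IsOpen (O t) := fun t ht => isOpen_iUnion fun N =>
    ((hB.isOpen ht.2.1).preimage (hcont N _)).inter
      (isOpen_biInter_finset fun j _ => (hB.isOpen ht.2.2.1).preimage (hcont N j))
  have hD : ∀ t ∈ S, Dense (O t) := by
    rintro t ⟨hm, hV, hW, h0, g, hgV, hg⟩
    rw [dense_iff_inter_open]
    rintro _ ⟨U, hU, rfl⟩ ⟨f, hf⟩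
    obtain ⟨h, hhU, hh, N, h1, h2⟩ := exists_pow_mem ha₀ ha₁ hm hU (hB.isOpen hV) (hB.isOpen hW)
      hf f.2 hgV hg h0
    exact ⟨⟨h, hh⟩, hhU, mem_iUnion.2
      ⟨N, h1, mem_iInter₂.2 fun j hj => h2 j (Finset.mem_range.1 hj)⟩⟩
  have hne : ((⟨1, differentiable_const 1⟩ : Entire)) ≠ 0 := fun h => by
    have := congrArg (fun f : Entire => f.1 0) h
    exact one_ne_zero this
  obtain ⟨f, hf0, hf⟩ := (dense_biInter_of_isOpen hO hS hD).inter_open_nonempty {0}ᶜ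
    isOpen_compl_singleton ⟨_, hne⟩
  refine ⟨f, hf0, fun m hm g hg V hV W hW => ?_⟩
  obtain ⟨V', hV', hgV', hVV'⟩ := hB.mem_nhds_iff.1 hV
  obtain ⟨W', hW', h0W', hWW'⟩ := hB.mem_nhds_iff.1 hW
  obtain ⟨N, h1, h2⟩ := mem_iUnion.1
    (mem_iInter₂.1 hf (m, V', W') ⟨hm, hV', hW', h0W', g, hgV', hg⟩)
  exact ⟨N, hVV' h1, fun j hj => hWW' (mem_iInter₂.1 h2 j (Finset.mem_range.2 hj))⟩

lemma exists_aeval_mem {a : ℝ} {f : C(ℂ, ℂ)}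
    (hf : ∀ m > 0, ∀ g : C(ℂ, ℂ), Differentiable ℂ g → ∀ V ∈ 𝓝 g, ∀ W ∈ 𝓝 (0 : C(ℂ, ℂ)),
      ∃ N : ℕ, (shiftOp a ^ N) (f ^ m) ∈ V ∧ ∀ j < m, (shiftOp a ^ N) (f ^ j) ∈ W)
    {P : Polynomial ℂ} (hP : 0 < P.natDegree) {g : C(ℂ, ℂ)} (hg : Differentiable ℂ g)
    {U : Set C(ℂ, ℂ)} (hU : U ∈ 𝓝 g) :
    ∃ N : ℕ, (shiftOp a ^ N) (Polynomial.aeval f P) ∈ U := by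
  have hlead : P.leadingCoeff ≠ 0 := Polynomial.leadingCoeff_ne_zero.2 fun h => by simp [h] at hP
  set g' := P.leadingCoeff⁻¹ • g
  have hg' : Differentiable ℂ g' := hg.const_smul P.leadingCoeff⁻¹
  obtain ⟨V, hV⟩ := (𝓝 g').exists_antitone_basis
  obtain ⟨W, hW⟩ := (𝓝 (0 : C(ℂ, ℂ))).exists_antitone_basis
  choose N hN₁ hN₂ using fun i => hf _ hP g' hg' (V i) (hV.mem i) (W i) (hW.mem i)
  have htop : Tendsto (fun i => (shiftOp a ^ N i) (f ^ P.natDegree)) atTop (𝓝 g') :=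
    hV.tendsto hN₁
  have hlow : ∀ j ∈ Finset.range P.natDegree,
      Tendsto (fun i => P.coeff j • (shiftOp a ^ N i) (f ^ j)) atTop (𝓝 0) := fun j hj => by
    have := (hW.tendsto fun i => hN₂ i j (Finset.mem_range.1 hj)).const_smul (P.coeff j)
    exact (smul_zero (A := C(ℂ, ℂ)) (P.coeff j)) ▸ this
  have hlim := (tendsto_finsetSum _ hlow).add (htop.const_smul P.leadingCoeff)
  rw [Finset.sum_const_zero, zero_add, smul_inv_smul₀ hlead] at hlim
  obtain ⟨i, hi⟩ := (hlim.eventually hU).exists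
  refine ⟨N i, ?_⟩
  rw [Polynomial.aeval_eq_sum_range, map_sum, Finset.sum_range_succ, Polynomial.coeff_natDegree]
  simp only [map_smul]
  exact hi

/-- For `0 < a ≤ 1`, the operator `e^D − aI`, given by
`(Tf)(z) = f(z + 1) − a f(z)`, supports a hypercyclic algebra on `H(ℂ)`. -/
theorem stmt9 (a : ℝ) (ha₀ : 0 < a) (ha₁ : a ≤ 1) (T : Entire → Entire)
    (hT : ∀ (f : Entire) (z : ℂ), (T f).1 z = f.1 (z + 1) - (a : ℂ) * f.1 z) :
    ∃ f : Entire, f ≠ 0 ∧ GeneratesHCAlgebra T f := by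
  obtain ⟨f, hf0, hf⟩ := exists_entire_pow_mem ha₀ ha₁
  refine ⟨f, hf0, fun P hP0 hPf => ?_⟩
  have hdeg : 0 < P.natDegree := by
    by_contra hcon
    have hP : P = 0 := by
      rw [Polynomial.eq_C_of_natDegree_eq_zero (Nat.eq_zero_of_not_pos hcon), hP0, Polynomial.C_0]
    refine hPf (Subtype.ext (ContinuousMap.ext fun z => ?_))
    change P.eval (f.1 z) = 0
    rw [hP, Polynomial.eval_zero]
  have hiter : ∀ n h, (T^[n] h).1 = (shiftOp a ^ n) h.1 := fun n h => by
    induction n with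
    | zero => rfl
    | succ n ih =>
      rw [Function.iterate_succ_apply', pow_succ', mul_apply_eq_comp, ← ih]
      exact ContinuousMap.ext fun z => hT _ z
  have hpoly : (polyApply P f).1 = Polynomial.aeval f.1 P := ContinuousMap.ext fun z =>
    (Polynomial.aeval_continuousMap_apply P f.1 z).symm
  refine dense_iff_inter_open.2 ?_
  rintro _ ⟨U, hU, rfl⟩ ⟨g, hg⟩
  obtain ⟨N, hN⟩ := exists_aeval_mem hf hdeg g.2 (hU.mem_nhds hg)
  refine ⟨_, ?_, N, rfl⟩
  rwa [mem_preimage, hiter, hpoly]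
end
end

section
/- For each real number a ≠ 0, the translation operator τ_a on C^∞(ℝ, ℝ), (τ_a f)(x) = f(x + a), is weakly mixing: the map τ_a ⊕ τ_a is topologically transitive on C^∞(ℝ,ℝ) × C^∞(ℝ,ℝ). Concretely, for all f₁, f₂, g₁, g₂ ∈ C^∞(ℝ,ℝ), every k ∈ ℕ and every ε > 0, there exist h₁, h₂ ∈ C^∞(ℝ,ℝ) and n ∈ ℕ such that P_k(h_i − f_i) < ε and P_k(τ_aⁿ h_i − g_i) < ε for i = 1, 2. -/
open Set

noncomputable section

/-- The space `C^∞(ℝ, ℝ)` of infinitely differentiable real-valued functions on `ℝ`. -/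
def SmoothR : Type := {f : ℝ → ℝ // ContDiff ℝ (⊤ : ℕ∞) f}

instance : Zero SmoothR := ⟨⟨fun _ => 0, contDiff_const⟩⟩
instance : Add SmoothR := ⟨fun f g => ⟨fun x => f.1 x + g.1 x, f.2.add g.2⟩⟩
instance : Mul SmoothR := ⟨fun f g => ⟨fun x => f.1 x * g.1 x, f.2.mul g.2⟩⟩
instance : SMul ℝ SmoothR := ⟨fun c f => ⟨fun x => c * f.1 x, contDiff_const.mul f.2⟩⟩

/-- Hypercyclicity in `C^∞(ℝ, ℝ)`: density of the orbit with respect to the seminorms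
`P_k(f) = max_{0 ≤ j ≤ k} max_{t ∈ [-k,k]} |f⁽ʲ⁾(t)|`. -/
def HCsmoothR (T : SmoothR → SmoothR) (f : SmoothR) : Prop :=
  ∀ g : SmoothR, ∀ k : ℕ, ∀ ε : ℝ, 0 < ε → ∃ n : ℕ, ∀ j ≤ k, ∀ t ∈ Icc (-(k:ℝ)) (k:ℝ),
    |iteratedDeriv j (T^[n] f).1 t - iteratedDeriv j g.1 t| < ε

theorem SmoothR.iterate_translate {a : ℝ} {T : SmoothR → SmoothR}
    (hT : ∀ (f : SmoothR) (x : ℝ), (T f).1 x = f.1 (x + a)) (n : ℕ) (f : SmoothR) (x : ℝ) :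
    (T^[n] f).1 x = f.1 (x + n * a) := by
  induction n generalizing x with
  | zero => simp
  | succ n ih =>
    rw [Function.iterate_succ_apply', hT, ih]
    exact congrArg f.1 (by push_cast; ring)

/-- Two smooth functions can be glued: one on `(-r, r)`, the other on a far translate of it. -/
theorem SmoothR.exists_glue (f g : SmoothR) {r s : ℝ} (hr : 0 < r) (hs : 2 * r + 1 ≤ |s|) :
    ∃ h : SmoothR, (∀ x ∈ Metric.ball (0 : ℝ) r, h.1 x = f.1 x) ∧
      ∀ x ∈ Metric.ball (0 : ℝ) r, h.1 (x + s) = g.1 x := by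
  let φ : ContDiffBump (0 : ℝ) := ⟨r, r + 1, hr, by linarith⟩
  have hφ : ContDiff ℝ (⊤ : ℕ∞) φ := φ.contDiff
  refine ⟨⟨fun x => φ x * f.1 x + (1 - φ x) * g.1 (x - s),
    (hφ.mul f.2).add ((contDiff_const.sub hφ).mul
      (g.2.comp (contDiff_id.sub contDiff_const)))⟩, fun x hx => ?_, fun x hx => ?_⟩
  · have h1 : φ x = 1 := φ.one_of_mem_closedBall (Metric.ball_subset_closedBall hx)
    simp [h1]
  · have hx' : |x| < r := by simpa using hx
    have h0 : φ (x + s) = 0 := by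
      apply φ.zero_of_le_dist
      have h2 : |s| ≤ |x + s| + |x| := by
        simpa using abs_sub (x + s) x
      change r + 1 ≤ dist (x + s) 0
      rw [Real.dist_eq, sub_zero]
      linarith
    simp [h0]

theorem iteratedDeriv_eq_of_eqOn_ball {f g : ℝ → ℝ} {r t : ℝ}
    (h : ∀ x ∈ Metric.ball (0 : ℝ) r, f x = g x) (ht : t ∈ Metric.ball (0 : ℝ) r) (j : ℕ) :
    iteratedDeriv j f t = iteratedDeriv j g t :=
  Filter.EventuallyEq.iteratedDeriv_eq j
    (Filter.eventually_of_mem (Metric.isOpen_ball.mem_nhds ht) h)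

/-- For `a ≠ 0`, the translation operator `τ_a` on `C^∞(ℝ, ℝ)` is weakly
mixing: `τ_a ⊕ τ_a` is topologically transitive, stated concretely via the seminorms `P_k`. -/
theorem stmt12 (a : ℝ) (ha : a ≠ 0) (T : SmoothR → SmoothR)
    (hT : ∀ (f : SmoothR) (x : ℝ), (T f).1 x = f.1 (x + a)) :
    ∀ f₁ f₂ g₁ g₂ : SmoothR, ∀ k : ℕ, ∀ ε : ℝ, 0 < ε →
      ∃ h₁ h₂ : SmoothR, ∃ n : ℕ,
        (∀ j ≤ k, ∀ t ∈ Icc (-(k:ℝ)) (k:ℝ),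
          |iteratedDeriv j h₁.1 t - iteratedDeriv j f₁.1 t| < ε) ∧
        (∀ j ≤ k, ∀ t ∈ Icc (-(k:ℝ)) (k:ℝ),
          |iteratedDeriv j h₂.1 t - iteratedDeriv j f₂.1 t| < ε) ∧
        (∀ j ≤ k, ∀ t ∈ Icc (-(k:ℝ)) (k:ℝ),
          |iteratedDeriv j (T^[n] h₁).1 t - iteratedDeriv j g₁.1 t| < ε) ∧
        (∀ j ≤ k, ∀ t ∈ Icc (-(k:ℝ)) (k:ℝ),
          |iteratedDeriv j (T^[n] h₂).1 t - iteratedDeriv j g₂.1 t| < ε) := by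
  intro f₁ f₂ g₁ g₂ k ε hε
  have hr : (0 : ℝ) < k + 1 := by positivity
  obtain ⟨n, hn⟩ := exists_nat_ge ((2 * ((k : ℝ) + 1) + 1) / |a|)
  have hs : 2 * ((k : ℝ) + 1) + 1 ≤ |(n : ℝ) * a| := by
    rw [abs_mul, Nat.abs_cast]
    exact (div_le_iff₀ (abs_pos.2 ha)).1 hn
  obtain ⟨h₁, hf₁, hg₁⟩ := SmoothR.exists_glue f₁ g₁ hr hs
  obtain ⟨h₂, hf₂, hg₂⟩ := SmoothR.exists_glue f₂ g₂ hr hs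
  have close : ∀ u v : ℝ → ℝ, (∀ x ∈ Metric.ball (0 : ℝ) (k + 1), u x = v x) →
      ∀ j ≤ k, ∀ t ∈ Icc (-(k : ℝ)) (k : ℝ), |iteratedDeriv j u t - iteratedDeriv j v t| < ε := by
    intro u v huv j _ t ht
    have htb : t ∈ Metric.ball (0 : ℝ) (k + 1) := by
      rw [mem_ball_zero_iff, Real.norm_eq_abs]
      linarith [abs_le.2 ht]
    rw [iteratedDeriv_eq_of_eqOn_ball huv htb j, sub_self, abs_zero]
    exact hε
  exact ⟨h₁, h₂, n, close _ _ hf₁, close _ _ hf₂,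
    close _ _ fun x hx => (SmoothR.iterate_translate hT n h₁ x).trans (hg₁ x hx),
    close _ _ fun x hx => (SmoothR.iterate_translate hT n h₂ x).trans (hg₂ x hx)⟩
end
end

section
/- For each real number a ≠ 0, the translation operator τ_a on C^∞(ℝ, ℝ), (τ_a f)(x) = f(x + a), does not support a hypercyclic algebra: there is no non-unital subalgebra A ≠ {0} of C^∞(ℝ,ℝ) all of whose nonzero elements are hypercyclic for τ_a. In particular, for every f ∈ C^∞(ℝ,ℝ) the function f² is not hypercyclic for τ_a. -/
open Set

noncomputable section

/-- Some iterate of a hypercyclic function takes a negative value. -/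
theorem HCsmoothR.exists_iterate_neg {T : SmoothR → SmoothR} {f : SmoothR}
    (hf : HCsmoothR T f) : ∃ n : ℕ, (T^[n] f).1 0 < 0 := by
  obtain ⟨n, hn⟩ := hf ⟨fun _ => -1, contDiff_const⟩ 0 1 one_pos
  have h := hn 0 le_rfl 0 (by simp)
  simp only [iteratedDeriv_zero] at h
  exact ⟨n, by linarith [(abs_lt.mp h).2]⟩

/-- Iterates of a translation operator preserve pointwise nonnegativity. -/
theorem iterate_translation_nonneg {a : ℝ} {T : SmoothR → SmoothR}
    (hT : ∀ (f : SmoothR) (x : ℝ), (T f).1 x = f.1 (x + a)) {f : SmoothR}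
    (hf : ∀ x, 0 ≤ f.1 x) (n : ℕ) (x : ℝ) : 0 ≤ (T^[n] f).1 x := by
  induction n generalizing x with
  | zero => exact hf x
  | succ n ih =>
    rw [Function.iterate_succ_apply', hT]
    exact ih _

/-- A square is not hypercyclic for a translation operator. -/
theorem not_hcsmoothR_mul_self {a : ℝ} {T : SmoothR → SmoothR}
    (hT : ∀ (f : SmoothR) (x : ℝ), (T f).1 x = f.1 (x + a)) (f : SmoothR) :
    ¬ HCsmoothR T (f * f) := by
  intro h
  obtain ⟨n, hn⟩ := h.exists_iterate_neg
  exact hn.not_ge (iterate_translation_nonneg hT (fun x => mul_self_nonneg (f.1 x)) n 0)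

theorem SmoothR.mul_self_ne_zero {f : SmoothR} (hf : f ≠ 0) : f * f ≠ 0 := by
  intro h
  apply hf
  apply Subtype.ext
  funext x
  exact mul_self_eq_zero.mp (congrFun (congrArg Subtype.val h) x)

/-- For `a ≠ 0`, the translation operator `τ_a` on `C^∞(ℝ, ℝ)` does not
support a hypercyclic algebra; in particular no square `f²` is hypercyclic for `τ_a`. -/
theorem stmt13 (a : ℝ) (ha : a ≠ 0) (T : SmoothR → SmoothR)
    (hT : ∀ (f : SmoothR) (x : ℝ), (T f).1 x = f.1 (x + a)) :
    (¬ ∃ A : Set SmoothR,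
      (0 : SmoothR) ∈ A ∧
      (∀ f ∈ A, ∀ g ∈ A, f + g ∈ A) ∧
      (∀ f ∈ A, ∀ g ∈ A, f * g ∈ A) ∧
      (∀ (c : ℝ), ∀ f ∈ A, c • f ∈ A) ∧
      A ≠ {0} ∧
      (∀ f ∈ A, f ≠ 0 → HCsmoothR T f)) ∧
    ∀ f : SmoothR, ¬ HCsmoothR T (f * f) := by
  refine ⟨?_, not_hcsmoothR_mul_self hT⟩
  rintro ⟨A, h0, -, hmul, -, hA, hHC⟩
  refine hA (eq_singleton_iff_unique_mem.mpr ⟨h0, fun f hf => ?_⟩)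
  by_contra hne
  exact not_hcsmoothR_mul_self hT f (hHC _ (hmul f hf f hf) (SmoothR.mul_self_ne_zero hne))
end
end

section
/- Let P be a non-constant complex polynomial and let B : ℝ → ℂ be an infinitely differentiable function which is constant outside of a compact set (i.e., there exist a compact K ⊆ ℝ and c ∈ ℂ with B(x) = c for all x ∉ K). Assume that the range of B is disjoint from P({z ∈ ℂ : P′(z) = 0}), i.e., for every z ∈ ℂ with P′(z) = 0 and every x ∈ ℝ, P(z) ≠ B(x). Then there exists an infinitely differentiable function g : ℝ → ℂ such that P(g(x)) = B(x) for all x ∈ ℝ. -/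
open Set Polynomial

/-- Near a point where `P'` does not vanish, a continuous lift along `P` of a `C^n` map
is itself `C^n`. -/
theorem Polynomial.contDiffAt_of_eval_comp {E : Type*} [NormedAddCommGroup E] [NormedSpace ℝ E]
    (P : Polynomial ℂ) {n : WithTop ℕ∞} {g B : E → ℂ} {x : E} (hg : ContinuousAt g x)
    (hB : ContDiffAt ℝ n B x) (hPg : ∀ y, P.eval (g y) = B y)
    (hx : P.derivative.eval (g x) ≠ 0) : ContDiffAt ℝ n g x := by
  have hstrict := (P.hasStrictDerivAt (g x)).hasStrictFDerivAt_equiv hx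
  let e := hstrict.toOpenPartialHomeomorph (fun z ↦ P.eval z)
  have hmem : g x ∈ e.source := hstrict.mem_toOpenPartialHomeomorph_source
  have hleft : e.symm (B x) = g x := by
    rw [← hPg x]
    exact e.left_inv hmem
  have htarget : B x ∈ e.target := by
    rw [← hPg x]
    exact e.map_source hmem
  have hsymm : ContDiffAt ℂ n e.symm (B x) := by
    refine e.contDiffAt_symm_deriv hx htarget ?_ ?_
    · rw [hleft]
      exact P.hasDerivAt (g x)
    · exact (Polynomial.contDiff_aeval P n).contDiffAt
  refine ((hsymm.restrict_scalars ℝ).comp x hB).congr_of_eventuallyEq ?_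
  filter_upwards [hg.eventually_mem (e.open_source.mem_nhds hmem)] with y hy
  rw [Function.comp_apply, ← hPg y]
  exact (e.left_inv hy).symm

/-- Lemma 13 of the paper. If `P` is a non-constant complex polynomial and
`B : ℝ → ℂ` is smooth, constant outside a compact set, with range disjoint from the set of
critical values `P({P′ = 0})`, then `B` admits a smooth `P`-th root: `P(g) = B` for some
smooth `g`. -/
theorem stmt15 (P : Polynomial ℂ) (hP : 0 < P.natDegree)
    (B : ℝ → ℂ) (hB : ContDiff ℝ (⊤ : ℕ∞) B)
    (K : Set ℝ) (hK : IsCompact K) (c : ℂ) (hconst : ∀ x ∉ K, B x = c)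
    (hrange : ∀ z : ℂ, (Polynomial.derivative P).eval z = 0 → ∀ x : ℝ, P.eval z ≠ B x) :
    ∃ g : ℝ → ℂ, ContDiff ℝ (⊤ : ℕ∞) g ∧ ∀ x : ℝ, P.eval (g x) = B x := by
  obtain ⟨z₀, hz₀⟩ := IsAlgClosed.eval_surjective hP.ne' (B 0)
  obtain ⟨g, ⟨-, hg⟩, -⟩ := P.isCoveringMapOn_eval.existsUnique_continuousMap_lifts
    ⟨B, hB.continuous⟩ (a₀ := 0) hz₀ (by
      rintro x ⟨z, hz, hzx⟩
      exact hrange z hz x hzx)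
  have hPg : ∀ x, P.eval (g x) = B x := congrFun hg
  exact ⟨g, contDiff_iff_contDiffAt.2 fun x ↦ P.contDiffAt_of_eval_comp g.continuous.continuousAt
    hB.contDiffAt hPg fun h ↦ hrange _ h x (hPg x), hPg⟩
end

section
/- Let Ω ⊆ ℂ be a domain (nonempty, open, connected), let ω : Ω → ℂ be holomorphic and zero-free, let φ : Ω → Ω be holomorphic, and let C_{ω,φ} : H(Ω) → H(Ω) be the weighted composition operator C_{ω,φ}(f) = ω·(f ∘ φ). Then for every f ∈ H(Ω) and every a ∈ Ω, the function z ↦ (z − a)³ does not belong to the closure in H(Ω) of the set {λ · C_{ω,φ}ⁿ(f²) : λ ∈ ℂ, n ∈ ℕ}. In particular, f² is not supercyclic for C_{ω,φ}. -/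
open Set

noncomputable section

/-- Supercyclicity of `f` for a map `T` on `H(Ω)`: density of the projective orbit
`{λ Tⁿ f}` in the topology of uniform convergence on compact subsets of `Ω`. -/
def SupercyclicOn (Ω : Set ℂ) (T : (ℂ → ℂ) → (ℂ → ℂ)) (f : ℂ → ℂ) : Prop :=
  ∀ g : ℂ → ℂ, DifferentiableOn ℂ g Ω →
    ∀ K ⊆ Ω, IsCompact K → ∀ ε : ℝ, 0 < ε →
      ∃ (lam : ℂ) (n : ℕ), ∀ z ∈ K, ‖lam • (T^[n] f) z - g z‖ < ε

/-- A convex open subset of `ℂ` carries a continuous square root of every continuous zero-free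
function. -/
theorem exists_continuousOn_mul_self_eq_of_convex {U : Set ℂ} (hU : Convex ℝ U) (hUo : IsOpen U)
    (hne : U.Nonempty) {w : ℂ → ℂ} (hw : ContinuousOn w U) (hw0 : ∀ z ∈ U, w z ≠ 0) :
    ∃ s : ℂ → ℂ, ContinuousOn s U ∧ ∀ z, s z * s z = w z := by
  have : ContractibleSpace U := hU.contractibleSpace hne
  have hsc : IsSimplyConnected U := inferInstanceAs (SimplyConnectedSpace U)
  obtain ⟨s, hs, hsw⟩ := Complex.exists_continuousOn_pow_eq hsc hUo hw
    (by rintro ⟨z, hz, h⟩; exact hw0 z hz h) two_ne_zero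
  exact ⟨s, hs, fun z => by rw [← sq, hsw]⟩

/-- On a circle around `a`, the square of a continuous function cannot be uniformly closer to
`(z - a) ^ 3` than the cube of the radius, because its winding number would be odd. -/
theorem exists_mem_sphere_le_norm_mul_self_sub_cube {a : ℂ} {r : ℝ} (hr : 0 < r) {h : ℂ → ℂ}
    (hh : ContinuousOn h (Metric.sphere a r)) :
    ∃ z ∈ Metric.sphere a r, r ^ 3 ≤ ‖h z * h z - (z - a) ^ 3‖ := by
  by_contra! hlt
  have hmem : ∀ t : ℝ, circleMap a r t ∈ Metric.sphere a r :=
    fun t => circleMap_mem_sphere a hr.le t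
  let e : ℝ → ℂ := fun t => Complex.exp (-(t * Complex.I * (3 / 2)))
  let G : ℝ → ℂ := fun t => h (circleMap a r t) * e t
  have hG : Continuous G := by
    have h1 : Continuous fun t => h (circleMap a r t) :=
      hh.comp_continuous (continuous_circleMap a r) hmem
    have h2 : Continuous e := by fun_prop
    exact h1.mul h2
  have he : ∀ t : ℝ, e t * e t * Complex.exp (t * Complex.I) ^ 3 = 1 := by
    intro t
    simp only [e]
    rw [← Complex.exp_nat_mul, ← Complex.exp_add, ← Complex.exp_add, ← Complex.exp_zero]
    congr 1
    push_cast
    ring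
  have hnorm : ∀ t : ℝ, ‖e t‖ = 1 := by
    intro t
    simp [e, Complex.norm_exp]
  have hre : ∀ t, (G t).re ≠ 0 := by
    intro t h0
    have hsq : ‖G t * G t - (r : ℂ) ^ 3‖ < r ^ 3 := by
      have key : G t * G t - (r : ℂ) ^ 3 = (h (circleMap a r t) * h (circleMap a r t) -
          (circleMap a r t - a) ^ 3) * (e t * e t) := by
        rw [circleMap_sub_center, circleMap_zero]
        simp only [G]
        linear_combination (r : ℂ) ^ 3 * he t
      rw [key, norm_mul, norm_mul, hnorm]
      simpa using hlt _ (hmem t)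
    have h1 := (Complex.abs_re_le_norm _).trans_lt hsq
    have h2 : ((r : ℂ) ^ 3).re = r ^ 3 := by
      rw [← Complex.ofReal_pow, Complex.ofReal_re]
    rw [Complex.sub_re, Complex.mul_re, h0, h2, abs_lt] at h1
    nlinarith [mul_self_nonneg (G t).im]
  have hend : G (2 * Real.pi) = -G 0 := by
    have h1 : circleMap a r (2 * Real.pi) = circleMap a r 0 := by
      simpa using periodic_circleMap a r 0
    have h2 : e (2 * Real.pi) = -e 0 := by
      have : -(((2 * Real.pi : ℝ) : ℂ) * Complex.I * (3 / 2)) =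
          Real.pi * Complex.I - (2 : ℕ) * (2 * Real.pi * Complex.I) := by
        push_cast; ring
      simp only [e]
      rw [this, Complex.exp_sub, Complex.exp_nat_mul]
      simp
    simp only [G, h1, h2, mul_neg]
  have hcont : Continuous fun t => (G t).re := Complex.continuous_re.comp hG
  have hzero : (0 : ℝ) ∈ uIcc (G 0).re (G (2 * Real.pi)).re := by
    rw [hend, Complex.neg_re, mem_uIcc]
    rcases le_total (G 0).re 0 with h | h
    · left; constructor <;> linarith
    · right; constructor <;> linarith
  obtain ⟨t, -, ht⟩ := intermediate_value_uIcc hcont.continuousOn hzero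
  exact hre t ht

/-- Iterates of a weighted composition operator are weighted composition operators. -/
theorem exists_weight_iterate_weightedComp {Ω : Set ℂ} {ω φ : ℂ → ℂ} (hω : ContinuousOn ω Ω)
    (hω0 : ∀ z ∈ Ω, ω z ≠ 0) (hφ : ContinuousOn φ Ω) (hmaps : MapsTo φ Ω Ω)
    {T : (ℂ → ℂ) → (ℂ → ℂ)} (hT : ∀ (f : ℂ → ℂ) (z : ℂ), T f z = ω z * f (φ z)) (n : ℕ) :
    ∃ W : ℂ → ℂ, ContinuousOn W Ω ∧ (∀ z ∈ Ω, W z ≠ 0) ∧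
      ∀ f z, (T^[n] f) z = W z * f (φ^[n] z) := by
  induction n with
  | zero => exact ⟨1, continuousOn_const, by simp, by simp⟩
  | succ n ih =>
    obtain ⟨W, hW, hW0, hTW⟩ := ih
    refine ⟨fun z => ω z * W (φ z), hω.mul (hW.comp hφ hmaps),
      fun z hz => mul_ne_zero (hω0 z hz) (hW0 _ (hmaps hz)), fun f z => ?_⟩
    rw [Function.iterate_succ_apply', hT, hTW, Function.iterate_succ_apply, mul_assoc]

/-- key step of Theorem 16 of the paper. For a weighted composition
operator `C_{ω,φ}` on `H(Ω)` with zero-free holomorphic weight `ω` and holomorphic symbol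
`φ : Ω → Ω`, for every `f ∈ H(Ω)` and `a ∈ Ω` the function `(z − a)³` is not in the closure
of `{λ C_{ω,φ}ⁿ(f²)}`; in particular `f²` is not supercyclic for `C_{ω,φ}`. -/
theorem stmt18 (Ω : Set ℂ) (hΩo : IsOpen Ω) (hΩc : IsConnected Ω)
    (ω φ : ℂ → ℂ) (hω : DifferentiableOn ℂ ω Ω) (hωfree : ∀ z ∈ Ω, ω z ≠ 0)
    (hφ : DifferentiableOn ℂ φ Ω) (hmaps : MapsTo φ Ω Ω)
    (T : (ℂ → ℂ) → (ℂ → ℂ)) (hT : ∀ (f : ℂ → ℂ) (z : ℂ), T f z = ω z * f (φ z))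
    (f : ℂ → ℂ) (hf : DifferentiableOn ℂ f Ω) (a : ℂ) (ha : a ∈ Ω) :
    (∃ K ⊆ Ω, IsCompact K ∧ ∃ ε > (0:ℝ), ∀ (lam : ℂ) (n : ℕ),
      ∃ z ∈ K, ε ≤ ‖lam • (T^[n] (f * f)) z - (z - a) ^ 3‖) ∧
    ¬ SupercyclicOn Ω T (f * f) := by
  have hfar : ∃ K ⊆ Ω, IsCompact K ∧ ∃ ε > (0:ℝ), ∀ (lam : ℂ) (n : ℕ),
      ∃ z ∈ K, ε ≤ ‖lam • (T^[n] (f * f)) z - (z - a) ^ 3‖ := by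
    obtain ⟨R, hR, hball⟩ := Metric.isOpen_iff.mp hΩo a ha
    have hsphere : Metric.sphere a (R / 2) ⊆ Metric.ball a R :=
      Metric.sphere_subset_closedBall.trans (Metric.closedBall_subset_ball (by linarith))
    refine ⟨Metric.sphere a (R / 2), hsphere.trans hball, isCompact_sphere a _, (R / 2) ^ 3,
      by positivity, fun lam n => ?_⟩
    obtain ⟨W, hW, hW0, hTW⟩ := exists_weight_iterate_weightedComp hω.continuousOn hωfree
      hφ.continuousOn hmaps hT n
    obtain ⟨s, hs, hsW⟩ := exists_continuousOn_mul_self_eq_of_convex (convex_ball a R)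
      Metric.isOpen_ball (Metric.nonempty_ball.mpr hR) (hW.mono hball)
      fun z hz => hW0 z (hball hz)
    obtain ⟨c, hc⟩ := IsAlgClosed.exists_pow_nat_eq lam two_pos
    have hfφ : ContinuousOn (fun z => f (φ^[n] z)) Ω :=
      hf.continuousOn.comp (hφ.continuousOn.iterate hmaps n) (hmaps.iterate n)
    obtain ⟨z, hz, hle⟩ := exists_mem_sphere_le_norm_mul_self_sub_cube (half_pos hR)
      (h := fun z => c * (s z * f (φ^[n] z)))
      (continuousOn_const.mul ((hs.mono hsphere).mul (hfφ.mono (hsphere.trans hball))))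
    refine ⟨z, hz, hle.trans_eq ?_⟩
    rw [hTW, ← hsW, ← hc, Pi.mul_apply, smul_eq_mul]
    congr 2
    ring
  refine ⟨hfar, fun hsuper => ?_⟩
  obtain ⟨K, hK, hKc, ε, hε, hfar⟩ := hfar
  obtain ⟨lam, n, hclose⟩ := hsuper (fun z => (z - a) ^ 3) (by fun_prop) K hK hKc ε hε
  obtain ⟨z, hz, hle⟩ := hfar lam n
  exact (hclose z hz).not_ge hle
end
end

section
/- Let Ω ⊆ ℂ be a domain (nonempty, open, connected), let ω : Ω → ℂ be holomorphic, let φ : Ω → Ω be holomorphic, and let C_{ω,φ} : H(Ω) → H(Ω) be the weighted composition operator C_{ω,φ}(f) = ω·(f ∘ φ). Then C_{ω,φ} does not support a supercyclic algebra: there is no non-unital subalgebra A ≠ {0} of H(Ω) all of whose nonzero elements are supercyclic for C_{ω,φ}. -/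
open Set

noncomputable section

/-- On a disc, a nowhere vanishing holomorphic function has a holomorphic square root. -/
theorem exists_differentiableOn_sq_eq_on_ball {W : ℂ → ℂ} {c : ℂ} {r : ℝ} (hr : 0 < r)
    (hW : DifferentiableOn ℂ W (Metric.ball c r)) (hW0 : ∀ z ∈ Metric.ball c r, W z ≠ 0) :
    ∃ S : ℂ → ℂ, DifferentiableOn ℂ S (Metric.ball c r) ∧
      ∀ z ∈ Metric.ball c r, S z ^ 2 = W z := by
  have hquot : DifferentiableOn ℂ (fun z => deriv W z / W z) (Metric.ball c r) :=
    (hW.deriv Metric.isOpen_ball).div hW hW0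
  obtain ⟨L, hL⟩ := hquot.isExactOn_ball
  have hderiv : ∀ z ∈ Metric.ball c r, HasDerivAt (fun z => W z * Complex.exp (-L z)) 0 z := by
    intro z hz
    have h1 := (hW.differentiableAt (Metric.isOpen_ball.mem_nhds hz)).hasDerivAt
    refine (h1.mul (hL z hz).neg.cexp).congr_deriv ?_
    have := hW0 z hz
    field_simp
    ring
  obtain ⟨a, ha⟩ := IsAlgClosed.exists_pow_nat_eq (W c * Complex.exp (-L c)) two_pos
  have hconst : ∀ z ∈ Metric.ball c r,
      W z * Complex.exp (-L z) = W c * Complex.exp (-L c) := fun z hz =>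
    Metric.isOpen_ball.is_const_of_deriv_eq_zero (convex_ball c r).isPreconnected
      (fun w hw => (hderiv w hw).differentiableAt.differentiableWithinAt)
      (fun w hw => (hderiv w hw).deriv) hz (Metric.mem_ball_self hr)
  refine ⟨fun z => a * Complex.exp (L z / 2), fun z hz => ?_, fun z hz => ?_⟩
  · exact (((hL z hz).div_const 2).cexp.const_mul a).differentiableAt.differentiableWithinAt
  · simp only [mul_pow]
    rw [ha, ← hconst z hz, ← Complex.exp_nat_mul, mul_assoc, ← Complex.exp_add]
    simp [mul_div_cancel₀]

/-- The square of a holomorphic function is not uniformly close to a function with a simple zero: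
quantitatively, on a disc it cannot approximate `z ↦ z - c`. -/
theorem not_forall_norm_sq_sub_lt {G : ℂ → ℂ} {c : ℂ} {r ρ : ℝ} (hρ : 0 < ρ) (hρr : ρ < r)
    (hG : DifferentiableOn ℂ G (Metric.ball c r)) :
    ¬ ∀ z ∈ Metric.closedBall c ρ, ‖G z ^ 2 - (z - c)‖ < ρ / 100 := by
  intro h
  have hsub : Metric.closedBall c ρ ⊆ Metric.ball c r := Metric.closedBall_subset_ball hρr
  have hGc : HasDerivAt G (deriv G c) c :=
    (hG.differentiableAt
      (Metric.isOpen_ball.mem_nhds (Metric.mem_ball_self (hρ.trans hρr)))).hasDerivAt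
  have hGcl : DiffContOnCl ℂ G (Metric.ball c ρ) :=
    (hG.mono hsub).diffContOnCl_ball subset_rfl
  have hHcl : DiffContOnCl ℂ (fun z => G z ^ 2 - (z - c)) (Metric.ball c ρ) := by
    refine DifferentiableOn.diffContOnCl_ball (U := Metric.closedBall c ρ) ?_ subset_rfl
    exact ((hG.mono hsub).pow 2).sub (by fun_prop)
  have hs : √ρ ^ 2 = ρ := Real.sq_sqrt hρ.le
  have hs0 : 0 < √ρ := Real.sqrt_pos.2 hρ
  have hH' := Complex.norm_deriv_le_of_forall_mem_sphere_norm_le hρ hHcl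
    fun z hz => (h z (Metric.sphere_subset_closedBall hz)).le
  have hG' := Complex.norm_deriv_le_of_forall_mem_sphere_norm_le (C := 11 / 10 * √ρ) hρ hGcl
    fun z hz => by
      have h1 := h z (Metric.sphere_subset_closedBall hz)
      have h2 : ‖z - c‖ = ρ := by simpa [dist_eq_norm] using hz
      have h3 := norm_sub_norm_le (G z ^ 2) (z - c)
      rw [norm_pow, h2] at h3
      refine (sq_le_sq₀ (norm_nonneg _) (by positivity)).1 ?_
      nlinarith
  have hGc0 : ‖G c‖ ≤ 1 / 10 * √ρ := by
    have h1 := h c (Metric.mem_closedBall_self hρ.le)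
    rw [sub_self, sub_zero, norm_pow] at h1
    refine (sq_le_sq₀ (norm_nonneg _) (by positivity)).1 ?_
    nlinarith
  have hHd : deriv (fun z => G z ^ 2 - (z - c)) c = 2 * (G c * deriv G c) - 1 := by
    refine ((hGc.pow 2).sub ((hasDerivAt_id c).sub_const c)).deriv.trans ?_
    simp [mul_assoc]
  have hprod : ‖G c * deriv G c‖ ≤ 11 / 100 := by
    rw [norm_mul]
    calc ‖G c‖ * ‖deriv G c‖ ≤ (1 / 10 * √ρ) * (11 / 10 * √ρ / ρ) := by gcongr
      _ = 11 / 100 * (√ρ ^ 2 / ρ) := by ring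
      _ = 11 / 100 := by rw [hs, div_self hρ.ne', mul_one]
  have h1 : ρ / 100 / ρ = 1 / 100 := by field_simp
  rw [hHd, h1, norm_sub_rev] at hH'
  have h2 := norm_sub_norm_le (1 : ℂ) (2 * (G c * deriv G c))
  rw [norm_mul, norm_one, Complex.norm_ofNat] at h2
  linarith

/-- If a weighted composition operator has a supercyclic element, its weight has no zeros. -/
theorem SupercyclicOn.weight_ne_zero {Ω : Set ℂ} (hΩo : IsOpen Ω) {ω φ : ℂ → ℂ}
    {T : (ℂ → ℂ) → (ℂ → ℂ)} (hT : ∀ (f : ℂ → ℂ) (z : ℂ), T f z = ω z * f (φ z))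
    {f : ℂ → ℂ} (hf : SupercyclicOn Ω T f) {z₀ : ℂ} (hz₀ : z₀ ∈ Ω) : ω z₀ ≠ 0 := by
  intro hω
  obtain ⟨z₁, hz₁, hne⟩ : ∃ z₁ ∈ Ω, z₁ ≠ z₀ := by
    have h : ∀ᶠ z in nhdsWithin z₀ {z₀}ᶜ, z ∈ Ω := nhdsWithin_le_nhds (hΩo.mem_nhds hz₀)
    exact (h.and self_mem_nhdsWithin).exists
  have key : ∀ w : ℂ, ∃ lam : ℂ, ‖lam * f z₀ - 1‖ < 1 / 10 ∧ ‖lam * f z₁ - w‖ < 1 / 10 := by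
    intro w
    obtain ⟨lam, n, h⟩ := hf (fun z => 1 + (w - 1) / (z₁ - z₀) * (z - z₀)) (by fun_prop)
      {z₀, z₁} (by simp [insert_subset_iff, hz₀, hz₁]) (by simp) (1 / 10) (by norm_num)
    have h0 := h z₀ (by simp)
    have h1 := h z₁ (by simp)
    cases n with
    | zero =>
      refine ⟨lam, by simpa using h0, ?_⟩
      simpa [div_mul_cancel₀ _ (sub_ne_zero.2 hne)] using h1
    | succ n =>
      rw [Function.iterate_succ_apply', hT] at h0
      norm_num [hω] at h0
  obtain ⟨a, ha0, ha1⟩ := key 1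
  obtain ⟨b, hb0, hb1⟩ := key (-1)
  have near : ∀ x y v : ℂ, ‖x - 1‖ < 1 / 10 → ‖y - v‖ < 1 / 10 → ‖v‖ = 1 →
      ‖x * y - v‖ < 1 / 2 := by
    intro x y v hx hy hv
    have e : x * y - v = (x - 1) * (y - v) + (x - 1) * v + (y - v) := by ring
    rw [e]
    refine (norm_add₃_le).trans_lt ?_
    rw [norm_mul, norm_mul, hv]
    nlinarith [norm_nonneg (x - 1), norm_nonneg (y - v)]
  have h1 := near _ _ _ hb0 ha1 norm_one
  have h2 := near _ _ _ ha0 hb1 (by simp)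
  have e : (2 : ℂ) = (a * f z₀ * (b * f z₁) - -1) - (b * f z₀ * (a * f z₁) - 1) := by ring
  have h3 := norm_sub_le (a * f z₀ * (b * f z₁) - -1) (b * f z₀ * (a * f z₁) - 1)
  rw [← e, Complex.norm_ofNat] at h3
  linarith

/-- Iterates of a weighted composition operator with nonvanishing weight are weighted composition
operators with nonvanishing weights. -/
theorem exists_weight_iterate {Ω : Set ℂ} {ω φ : ℂ → ℂ} (hω : DifferentiableOn ℂ ω Ω)
    (hφ : DifferentiableOn ℂ φ Ω) (hmaps : MapsTo φ Ω Ω) (hω0 : ∀ z ∈ Ω, ω z ≠ 0)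
    {T : (ℂ → ℂ) → (ℂ → ℂ)} (hT : ∀ (f : ℂ → ℂ) (z : ℂ), T f z = ω z * f (φ z)) (n : ℕ) :
    ∃ W : ℂ → ℂ, DifferentiableOn ℂ W Ω ∧ (∀ z ∈ Ω, W z ≠ 0) ∧
      ∀ (f : ℂ → ℂ) (z : ℂ), T^[n] f z = W z * f (φ^[n] z) := by
  induction n with
  | zero => exact ⟨fun _ => 1, by fun_prop, by simp, by simp⟩
  | succ n ih =>
    obtain ⟨W, hW, hW0, hTW⟩ := ih
    refine ⟨fun z => ω z * W (φ z), hω.mul (hW.comp hφ hmaps),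
      fun z hz => mul_ne_zero (hω0 z hz) (hW0 _ (hmaps hz)), fun f z => ?_⟩
    rw [Function.iterate_succ_apply', hT, hTW, Function.iterate_succ_apply, mul_assoc]

/-- The square of a holomorphic function is never supercyclic for a weighted composition
operator. -/
theorem not_supercyclicOn_mul_self {Ω : Set ℂ} (hΩo : IsOpen Ω) (hΩ : Ω.Nonempty)
    {ω φ : ℂ → ℂ} (hω : DifferentiableOn ℂ ω Ω) (hφ : DifferentiableOn ℂ φ Ω)
    (hmaps : MapsTo φ Ω Ω) {T : (ℂ → ℂ) → (ℂ → ℂ)}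
    (hT : ∀ (f : ℂ → ℂ) (z : ℂ), T f z = ω z * f (φ z))
    {f : ℂ → ℂ} (hf : DifferentiableOn ℂ f Ω) : ¬ SupercyclicOn Ω T (f * f) := by
  intro hsup
  obtain ⟨c, hc⟩ := hΩ
  obtain ⟨r, hr, hball⟩ := Metric.isOpen_iff.1 hΩo c hc
  have hsub : Metric.closedBall c (r / 2) ⊆ Metric.ball c r :=
    Metric.closedBall_subset_ball (half_lt_self hr)
  obtain ⟨lam, n, h⟩ := hsup (fun z => z - c) (by fun_prop) _ (hsub.trans hball)
    (isCompact_closedBall c (r / 2)) (r / 2 / 100) (by positivity)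
  obtain ⟨W, hW, hW0, hTW⟩ :=
    exists_weight_iterate hω hφ hmaps (fun z hz => hsup.weight_ne_zero hΩo hT hz) hT n
  obtain ⟨S, hS, hSW⟩ := exists_differentiableOn_sq_eq_on_ball hr (hW.mono hball)
    fun z hz => hW0 z (hball hz)
  obtain ⟨μ, hμ⟩ := IsAlgClosed.exists_pow_nat_eq lam two_pos
  have hcomp : DifferentiableOn ℂ (fun z => f (φ^[n] z)) (Metric.ball c r) :=
    (hf.comp (hφ.iterate hmaps n) (hmaps.iterate n)).mono hball
  refine not_forall_norm_sq_sub_lt (half_pos hr) (half_lt_self hr)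
    ((hS.const_mul μ).mul hcomp) fun z hz => ?_
  have e : (μ * S z * f (φ^[n] z)) ^ 2 = lam • T^[n] (f * f) z := by
    rw [hTW, Pi.mul_apply, smul_eq_mul, ← hμ, ← hSW z (hsub hz)]
    ring
  exact (congrArg (fun w => ‖w - (z - c)‖) e).trans_lt (h z hz)

/-- Theorem 16 of the paper. No weighted composition operator
`C_{ω,φ} : H(Ω) → H(Ω)` supports a supercyclic algebra: there is no non-unital subalgebra
`A ≠ {0}` of `H(Ω)` all of whose elements which are nonzero (on `Ω`) are supercyclic. -/
theorem stmt19 (Ω : Set ℂ) (hΩo : IsOpen Ω) (hΩc : IsConnected Ω)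
    (ω φ : ℂ → ℂ) (hω : DifferentiableOn ℂ ω Ω)
    (hφ : DifferentiableOn ℂ φ Ω) (hmaps : MapsTo φ Ω Ω)
    (T : (ℂ → ℂ) → (ℂ → ℂ)) (hT : ∀ (f : ℂ → ℂ) (z : ℂ), T f z = ω z * f (φ z)) :
    ¬ ∃ A : Set (ℂ → ℂ),
      (∀ f ∈ A, DifferentiableOn ℂ f Ω) ∧
      (fun _ => (0:ℂ)) ∈ A ∧
      (∀ f ∈ A, ∀ g ∈ A, f + g ∈ A) ∧
      (∀ f ∈ A, ∀ g ∈ A, f * g ∈ A) ∧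
      (∀ (c : ℂ), ∀ f ∈ A, c • f ∈ A) ∧
      (∃ f ∈ A, ∃ z ∈ Ω, f z ≠ 0) ∧
      (∀ f ∈ A, (∃ z ∈ Ω, f z ≠ 0) → SupercyclicOn Ω T f) := by
  rintro ⟨A, hdiff, -, -, hmul, -, ⟨f, hfA, z, hz, hfz⟩, hsup⟩
  exact not_supercyclicOn_mul_self hΩo hΩc.nonempty hω hφ hmaps hT (hdiff f hfA)
    (hsup (f * f) (hmul f hfA f hfA) ⟨z, hz, mul_ne_zero hfz hfz⟩)
end
end
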